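/- Take σ = 1. Let F₁ ⊂ F₂ ⊂ … ⊂ F_m ⊂ ℝⁿ be strictly nested linear subspaces with dimensions d₁ < … < d_m < n and orthogonal projections Π_j, with Π_{m+1} the identity, and let ε_{2,j}, ε_{∞,j} > 0 for j = 1,…,m. Let 0 < γ < 1 and α₁,…,α_{m+1} ∈ (0,1) with ∑_{j=1}^{m+1} α_j ≤ α. For j ≤ m define T_j(Y) = ∑ᵢ (Yᵢ − (Π_jY)ᵢ)² and let q_j be the (1−γ)-quantile of the chi-squared distribution with n−d_j degrees of freedom. Let Ĵ = min{1 ≤ j ≤ m : T_j ≤ q_j}, with Ĵ = m+1 if no such j exists. Set z_j = Φ⁻¹(1 − α_j/(2n)), c_j = Ω_{F_j}·z_j + ε_{∞,j} for j ≤ m, and c_{m+1} = z_{m+1}; define the band L = Π_Ĵ Y − c_Ĵ·𝟙, U = Π_Ĵ Y + c_Ĵ·𝟙 (𝟙 the all-ones vector). Assume for each j ≤ m that for every a ∈ ℝ^{n−d_j} with ∑ₖ aₖ² ≥ n·ε_{2,j}², P( ∑ₖ (Zₖ + aₖ)² ≤ q_j ) ≤ α_j, where Z₁,…,Z_{n−d_j}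 are i.i.d. standard normal. Then: (i) for every f ∈ ℝⁿ, P_f( L ≤ g ≤ U for some g ∈ F⋆(f) ) ≥ 1 − α; and (ii) if c₁ ≤ c₂ ≤ … ≤ c_{m+1}, then for each j ≤ m and every f ∈ F_j, P_f( W ≤ 2c_j ) ≥ 1 − γ. -/

import Mathlib

open MeasureTheory ProbabilityTheory Real

noncomputable section

/-- Product Gaussian measure `N(f, σ² Iₙ)` on `ℝⁿ`. -/
def gaussP (n : ℕ) (f : Fin n → ℝ) (σ : ℝ) : Measure (Fin n → ℝ) :=
  Measure.pi fun i => gaussianReal (f i) (Real.toNNReal (σ ^ 2))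

/-- Standard normal CDF `Φ`. -/
def stdCDF (x : ℝ) : ℝ := ((gaussianReal 0 1) (Set.Iic x)).toReal

/-- Standard normal density `φ`. -/
def stdPDF (x : ℝ) : ℝ := Real.exp (-(x ^ 2) / 2) / Real.sqrt (2 * Real.pi)

/-- `τ(ε) = Φ(ε/2) - Φ(-ε/2)`. -/
def tau (ε : ℝ) : ℝ := stdCDF (ε / 2) - stdCDF (-(ε / 2))

/-- Inverse of `τ`. -/
def tauInv (p : ℝ) : ℝ := Function.invFun tau p

/-- Standard normal quantile function `Φ⁻¹`. -/
def PhiInv (p : ℝ) : ℝ := Function.invFun stdCDF p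

/-- Normalized Euclidean norm `‖v‖ = √((1/n) ∑ vᵢ²)`. -/
def norm2 (n : ℕ) (v : Fin n → ℝ) : ℝ := Real.sqrt ((∑ i, (v i) ^ 2) / n)

/-- Sup norm `‖v‖_∞ = maxᵢ |vᵢ|`. -/
def normInf (n : ℕ) (v : Fin n → ℝ) : ℝ := ⨆ i, |v i|

/-- Normalized inner product. -/
def inner2 (n : ℕ) (u v : Fin n → ℝ) : ℝ := (∑ i, u i * v i) / n

/-- Total variation distance between two measures on `ℝⁿ`. -/
def dTV (n : ℕ) (P Q : Measure (Fin n → ℝ)) : ℝ :=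
  ⨆ A : {A : Set (Fin n → ℝ) // MeasurableSet A}, |(P A).toReal - (Q A).toReal|

/-- Width of the band `(L, U)` at data `y`. -/
def width (n : ℕ) (L U : (Fin n → ℝ) → Fin n → ℝ) (y : Fin n → ℝ) : ℝ :=
  ⨆ i, (U y i - L y i)

/-- The band `(L,U)` covers `g` at data `y`. -/
def covers (n : ℕ) (L U : (Fin n → ℝ) → Fin n → ℝ) (g y : Fin n → ℝ) : Prop :=
  ∀ i, L y i ≤ g i ∧ g i ≤ U y i

/-- `P` is the orthogonal projection onto the subspace `F` of `ℝⁿ`. -/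
def IsOrthProjOn (n : ℕ) (F : Submodule ℝ (Fin n → ℝ))
    (P : (Fin n → ℝ) →ₗ[ℝ] (Fin n → ℝ)) : Prop :=
  (∀ f, P f ∈ F) ∧ (∀ f, ∀ g ∈ F, inner2 n (f - P f) g = 0)

/-- `Ω_F = max_i ‖Π_F eᵢ‖ / ‖eᵢ‖`. -/
def OmegaF (n : ℕ) (P : (Fin n → ℝ) →ₗ[ℝ] (Fin n → ℝ)) : ℝ :=
  ⨆ i : Fin n, norm2 n (P (Pi.single i 1)) / norm2 n (Pi.single i 1)

/-- The `p`-quantile of the chi-squared distribution with `m` degrees of freedom. -/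
def chiSqQuantile (m : ℕ) (p : ℝ) : ℝ :=
  sInf {t : ℝ | ENNReal.ofReal p ≤
    (Measure.pi fun _ : Fin m => gaussianReal 0 1) {z | ∑ k, (z k) ^ 2 ≤ t}}


/-- The nested surrogate set
`F⋆(f) = {Π_j f : ‖f−Π_j f‖ ≤ ε_{2,j}, ‖f−Π_j f‖_∞ > ε_{∞,j}} ∪ {f}`. -/
def surrogateSet (n m : ℕ) (Pj : Fin m → ((Fin n → ℝ) →ₗ[ℝ] (Fin n → ℝ)))
    (ε2 εinf : Fin m → ℝ) (f : Fin n → ℝ) : Set (Fin n → ℝ) :=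
  {g | g = f ∨ ∃ j : Fin m,
    norm2 n (f - Pj j f) ≤ ε2 j ∧ εinf j < normInf n (f - Pj j f) ∧ g = Pj j f}

/-- `T_j(Y) = ∑ᵢ (Yᵢ − (Π_jY)ᵢ)²`. -/
def Tj (n m : ℕ) (Pj : Fin m → ((Fin n → ℝ) →ₗ[ℝ] (Fin n → ℝ))) (j : Fin m)
    (y : Fin n → ℝ) : ℝ :=
  ∑ i, (y i - Pj j y i) ^ 2

/-- `q_j`: the `(1−γ)`-quantile of the chi-squared distribution with `n − d_j`
degrees of freedom. -/
def qj (n m : ℕ) (dd : Fin m → ℕ) (γ : ℝ) (j : Fin m) : ℝ :=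
  chiSqQuantile (n - dd j) (1 - γ)

/-- `Ĵ(y)`: the smallest `j` (0-based here) with `T_j ≤ q_j`, and `m` (meaning the
full model, i.e. `m+1` in 1-based counting) if there is none. -/
def Jhat (n m : ℕ) (Pj : Fin m → ((Fin n → ℝ) →ₗ[ℝ] (Fin n → ℝ)))
    (dd : Fin m → ℕ) (γ : ℝ) (y : Fin n → ℝ) : ℕ :=
  sInf ({j : ℕ | ∃ h : j < m, Tj n m Pj ⟨j, h⟩ y ≤ qj n m dd γ ⟨j, h⟩} ∪ {m})

/-- Half-width `c_j = Ω_{F_j}·z_j + ε_{∞,j}` for `j < m`, and `c = z` for the full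
model. -/
def cj (n m : ℕ) (Pj : Fin m → ((Fin n → ℝ) →ₗ[ℝ] (Fin n → ℝ)))
    (εinf : Fin m → ℝ) (αv : Fin (m + 1) → ℝ) (j : ℕ) : ℝ :=
  if h : j < m then
    OmegaF n (Pj ⟨j, h⟩) * PhiInv (1 - αv ⟨j, by omega⟩ / (2 * n)) + εinf ⟨j, h⟩
  else PhiInv (1 - αv ⟨m, by omega⟩ / (2 * n))

/-- Estimator `Π_Ĵ Y` (identity projection for the full model). -/
def centerHat (n m : ℕ) (Pj : Fin m → ((Fin n → ℝ) →ₗ[ℝ] (Fin n → ℝ)))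
    (dd : Fin m → ℕ) (γ : ℝ) (y : Fin n → ℝ) : Fin n → ℝ :=
  if h : Jhat n m Pj dd γ y < m then Pj ⟨Jhat n m Pj dd γ y, h⟩ y else y

/-- Lower band `Π_Ĵ Y − c_Ĵ·𝟙`. -/
def nbandL (n m : ℕ) (Pj : Fin m → ((Fin n → ℝ) →ₗ[ℝ] (Fin n → ℝ)))
    (dd : Fin m → ℕ) (γ : ℝ) (εinf : Fin m → ℝ) (αv : Fin (m + 1) → ℝ)
    (y : Fin n → ℝ) : Fin n → ℝ :=
  fun i => centerHat n m Pj dd γ y i - cj n m Pj εinf αv (Jhat n m Pj dd γ y)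

/-- Upper band `Π_Ĵ Y + c_Ĵ·𝟙`. -/
def nbandU (n m : ℕ) (Pj : Fin m → ((Fin n → ℝ) →ₗ[ℝ] (Fin n → ℝ)))
    (dd : Fin m → ℕ) (γ : ℝ) (εinf : Fin m → ℝ) (αv : Fin (m + 1) → ℝ)
    (y : Fin n → ℝ) : Fin n → ℝ :=
  fun i => centerHat n m Pj dd γ y i + cj n m Pj εinf αv (Jhat n m Pj dd γ y)

lemma stdCDF_eq_cdf : stdCDF = cdf (gaussianReal 0 1) := by
  ext x
  rw [cdf_eq_real]
  rfl

lemma continuous_stdCDF : Continuous stdCDF := by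
  rw [stdCDF_eq_cdf, continuous_iff_continuousAt]
  intro x
  rw [(monotone_cdf _).continuousAt_iff_leftLim_eq_rightLim, StieltjesFunction.rightLim_eq]
  have := nullSingletonClass_gaussianReal (μ := 0) (one_ne_zero (α := NNReal))
  have h1 := (cdf (gaussianReal 0 1)).measure_singleton x
  rw [measure_cdf, measure_singleton, eq_comm, ENNReal.ofReal_eq_zero] at h1
  exact le_antisymm ((monotone_cdf _).leftLim_le le_rfl) (by linarith)

lemma stdCDF_PhiInv {p : ℝ} (h0 : 0 < p) (h1 : p < 1) : stdCDF (PhiInv p) = p := by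
  refine Function.invFun_eq (f := stdCDF) ?_
  have hbot : ∃ x, stdCDF x < p := by
    rw [stdCDF_eq_cdf]
    exact ((tendsto_cdf_atBot _).eventually_lt_const h0).exists
  have htop : ∃ x, p < stdCDF x := by
    rw [stdCDF_eq_cdf]
    exact ((tendsto_cdf_atTop _).eventually_const_lt h1).exists
  obtain ⟨x, hx⟩ := hbot
  obtain ⟨y, hy⟩ := htop
  exact mem_range_of_exists_le_of_exists_ge continuous_stdCDF ⟨x, hx.le⟩ ⟨y, hy.le⟩

lemma gaussianReal_Ici_neg (z : ℝ) :
    gaussianReal 0 1 (Set.Ici (-z)) = gaussianReal 0 1 (Set.Iic z) := by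
  have h := gaussianReal_map_neg (μ := 0) (v := 1)
  rw [neg_zero] at h
  conv_lhs => rw [← h]
  rw [Measure.map_apply measurable_neg measurableSet_Ici]
  congr 1
  ext x
  simp

lemma nonneg_of_half_lt_stdCDF {z : ℝ} (hz : 1 / 2 < stdCDF z) : 0 ≤ z := by
  by_contra! hneg
  have hdisj : Disjoint (Set.Iic z) (Set.Ici (-z)) :=
    Set.disjoint_left.2 fun x hx hx' => by
      simp only [Set.mem_Iic, Set.mem_Ici] at hx hx'
      linarith
  have h := measureReal_union (μ := gaussianReal 0 1) hdisj measurableSet_Ici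
  have h1 : (gaussianReal 0 1).real (Set.Iic z ∪ Set.Ici (-z)) ≤ 1 := measureReal_le_one
  have h2 : (gaussianReal 0 1).real (Set.Ici (-z)) = stdCDF z := by
    rw [measureReal_def, gaussianReal_Ici_neg]
    rfl
  have h3 : (gaussianReal 0 1).real (Set.Iic z) = stdCDF z := rfl
  linarith

lemma gaussianReal_lt_abs_le (z : ℝ) :
    gaussianReal 0 1 {x | z < |x|} ≤ ENNReal.ofReal (2 * (1 - stdCDF z)) := by
  have hsub : {x : ℝ | z < |x|} ⊆ (Set.Iic z)ᶜ ∪ (Set.Ici (-z))ᶜ := by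
    intro x hx
    simp only [Set.mem_ofPred_eq, lt_abs] at hx
    rcases hx with hx | hx
    · left; simpa using hx
    · right; simp only [Set.mem_compl_iff, Set.mem_Ici, not_le]; linarith
  have h3 : (gaussianReal 0 1).real (Set.Iic z) = stdCDF z := rfl
  have h4 : (gaussianReal 0 1).real (Set.Ici (-z)) = stdCDF z := by
    rw [measureReal_def, gaussianReal_Ici_neg]
    rfl
  rw [← ENNReal.ofReal_toReal (measure_ne_top (gaussianReal 0 1) {x | z < |x|})]
  apply ENNReal.ofReal_le_ofReal
  calc (gaussianReal 0 1).real {x | z < |x|}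
      ≤ (gaussianReal 0 1).real ((Set.Iic z)ᶜ ∪ (Set.Ici (-z))ᶜ) := measureReal_mono hsub
    _ ≤ (gaussianReal 0 1).real (Set.Iic z)ᶜ + (gaussianReal 0 1).real (Set.Ici (-z))ᶜ :=
        measureReal_union_le _ _
    _ = 2 * (1 - stdCDF z) := by
        rw [probReal_compl_eq_one_sub measurableSet_Iic,
          probReal_compl_eq_one_sub measurableSet_Ici, h3, h4]
        ring

/-- The standard normal product measure on `ℝⁿ`. -/
abbrev stdPi (n : ℕ) : Measure (Fin n → ℝ) := Measure.pi fun _ => gaussianReal 0 1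

lemma gaussP_one_eq_map (n : ℕ) (f : Fin n → ℝ) :
    gaussP n f 1 = (stdPi n).map (fun x => x + f) := by
  have h := Measure.pi_map_pi (μ := fun _ : Fin n => gaussianReal 0 1)
    (f := fun i x => x + f i) (fun i => by fun_prop)
  have h' : (fun x : Fin n → ℝ => x + f) = fun x i => x i + f i := rfl
  rw [h', h, gaussP]
  congr 1
  ext1 i
  rw [gaussianReal_map_add_const]
  simp

lemma gaussP_one_apply {n : ℕ} (f : Fin n → ℝ) {s : Set (Fin n → ℝ)} (hs : MeasurableSet s) :
    gaussP n f 1 s = stdPi n {x | x + f ∈ s} := by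
  rw [gaussP_one_eq_map, Measure.map_apply (by fun_prop) hs]
  rfl

/-- Coordinates of a standard Gaussian vector along an orthonormal family are i.i.d. standard
normal. -/
lemma map_orthonormal_stdPi {n k : ℕ} {b : Fin k → EuclideanSpace ℝ (Fin n)}
    (hb : Orthonormal ℝ b) :
    (stdPi n).map (fun x l => ∑ i, b l i * x i) = stdPi k := by
  have hmeas : Measurable (fun (x : Fin n → ℝ) (l : Fin k) => ∑ i, b l i * x i) := by fun_prop
  suffices h : ((stdPi n).map (fun x l => ∑ i, b l i * x i)).map (WithLp.toLp 2) =
      (stdPi k).map (WithLp.toLp 2) by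
    have h2 := congrArg (Measure.map (WithLp.ofLp (p := 2))) h
    have hid (μ : Measure (Fin k → ℝ)) :
        (μ.map (WithLp.toLp 2)).map (WithLp.ofLp (p := 2)) = μ := by
      rw [Measure.map_map (by fun_prop) (by fun_prop)]
      exact Measure.map_id
    rwa [hid, hid] at h2
  apply Measure.ext_of_charFun (E := EuclideanSpace ℝ (Fin k))
  ext t
  rw [map_pi_eq_stdGaussian, charFun_stdGaussian, charFun_apply,
    Measure.map_map (by fun_prop) hmeas,
    integral_map ((by fun_prop : Measurable (WithLp.toLp 2)).comp hmeas).aemeasurable (by fun_prop)]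
  have hs := charFun_stdGaussian (∑ l, t l • b l)
  rw [← map_pi_eq_stdGaussian, charFun_apply, integral_map (by fun_prop) (by fun_prop)] at hs
  have hnorm : ‖∑ l, t l • b l‖ ^ 2 = ‖t‖ ^ 2 := by
    rw [← real_inner_self_eq_norm_sq, hb.inner_sum, EuclideanSpace.real_norm_sq_eq]
    simp [sq]
  rw [← Complex.ofReal_pow, hnorm, Complex.ofReal_pow] at hs
  rw [← hs]
  congr 1
  ext x
  congr 3
  simp only [Function.comp_apply, inner_sum, real_inner_smul_right]
  simp [PiLp.inner_apply]

lemma stdPi_lt_abs_sum_le {n : ℕ} (v : Fin n → ℝ) {Ω z : ℝ} (hz : 0 ≤ z)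
    (hv : √(∑ i, v i ^ 2) ≤ Ω) :
    stdPi n {x | Ω * z < |∑ i, v i * x i|} ≤ ENNReal.ofReal (2 * (1 - stdCDF z)) := by
  set s := √(∑ i, v i ^ 2) with hs
  have hs0 : 0 ≤ s := Real.sqrt_nonneg _
  rcases hs0.eq_or_lt with h0 | hpos
  · have hv0 : ∀ i, v i = 0 := by
      have h1 : ∑ i, v i ^ 2 = 0 := by
        rw [← Real.sqrt_eq_zero (Finset.sum_nonneg fun i _ => sq_nonneg _)]
        exact h0.symm
      intro i
      have := (Finset.sum_eq_zero_iff_of_nonneg (fun i _ => sq_nonneg (v i))).1 h1 i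
        (Finset.mem_univ i)
      simpa using this
    have hempty : {x : Fin n → ℝ | Ω * z < |∑ i, v i * x i|} = ∅ := by
      ext x
      simp only [hv0, zero_mul, Finset.sum_const_zero, abs_zero, Set.mem_ofPred_eq,
        Set.mem_empty_iff_false, iff_false, not_lt]
      exact mul_nonneg (hs0.trans hv) hz
    rw [hempty]
    simp
  · set b : Fin 1 → EuclideanSpace ℝ (Fin n) := fun _ => WithLp.toLp 2 fun i => v i / s
    have hb : Orthonormal ℝ b := by
      refine ⟨fun l => ?_, fun l l' hl => absurd (Subsingleton.elim l l') hl⟩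
      rw [EuclideanSpace.norm_eq]
      simp only [b, Real.norm_eq_abs, sq_abs, div_pow]
      rw [← Finset.sum_div, hs, Real.sq_sqrt (Finset.sum_nonneg fun i _ => sq_nonneg _), div_self,
        Real.sqrt_one]
      exact fun h => hpos.ne' (by rw [hs, h, Real.sqrt_zero])
    have heval : (stdPi 1).map (fun x => x 0) = gaussianReal 0 1 :=
      (measurePreserving_eval (fun _ : Fin 1 => gaussianReal 0 1) 0).map_eq
    rw [← map_orthonormal_stdPi hb, Measure.map_map (by fun_prop) (by fun_prop)] at heval
    refine le_trans ?_ (gaussianReal_lt_abs_le z)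
    have hset : MeasurableSet {x : ℝ | z < |x|} := measurableSet_lt (by fun_prop) (by fun_prop)
    rw [← heval, Measure.map_apply (by fun_prop) hset]
    refine measure_mono fun x hx => ?_
    simp only [Set.mem_ofPred_eq, Set.mem_preimage, Function.comp_apply, b] at hx ⊢
    have h1 : ∑ i, v i / s * x i = (∑ i, v i * x i) / s := by
      rw [Finset.sum_div]
      exact Finset.sum_congr rfl fun i _ => by ring
    rw [h1, abs_div, abs_of_pos hpos, lt_div_iff₀ hpos]
    calc z * s ≤ Ω * z := by nlinarith
      _ < _ := hx

lemma sum_mul_eq_zero_of_isOrthProjOn {n : ℕ} (hn : n ≠ 0) {F : Submodule ℝ (Fin n → ℝ)}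
    {P : (Fin n → ℝ) →ₗ[ℝ] (Fin n → ℝ)} (hP : IsOrthProjOn n F P) (f : Fin n → ℝ)
    {g : Fin n → ℝ} (hg : g ∈ F) : ∑ i, (f i - P f i) * g i = 0 := by
  have h := hP.2 f g hg
  rw [inner2, div_eq_zero_iff, or_iff_left (by exact_mod_cast hn)] at h
  exact h

lemma IsOrthProjOn.apply_eq_self {n : ℕ} (hn : n ≠ 0) {F : Submodule ℝ (Fin n → ℝ)}
    {P : (Fin n → ℝ) →ₗ[ℝ] (Fin n → ℝ)} (hP : IsOrthProjOn n F P) {f : Fin n → ℝ}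
    (hf : f ∈ F) : P f = f := by
  have h := sum_mul_eq_zero_of_isOrthProjOn hn hP f (F.sub_mem hf (hP.1 f))
  have h' := (Finset.sum_eq_zero_iff_of_nonneg
    (fun i _ => mul_self_nonneg (f i - P f i))).1 h
  ext i
  have := mul_self_eq_zero.1 (h' i (Finset.mem_univ i))
  linarith

lemma IsOrthProjOn.apply_eq_sum {n : ℕ} (hn : n ≠ 0) {F : Submodule ℝ (Fin n → ℝ)}
    {P : (Fin n → ℝ) →ₗ[ℝ] (Fin n → ℝ)} (hP : IsOrthProjOn n F P) (x : Fin n → ℝ) (i : Fin n) :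
    P x i = ∑ k, P (Pi.single i 1) k * x k := by
  have h1 := sum_mul_eq_zero_of_isOrthProjOn hn hP (Pi.single i 1) (hP.1 x)
  have h2 := sum_mul_eq_zero_of_isOrthProjOn hn hP x (hP.1 (Pi.single i 1))
  simp only [sub_mul, Finset.sum_sub_distrib] at h1 h2
  have h3 : ∑ k, (Pi.single i 1 : Fin n → ℝ) k * P x k = P x i := by
    simp [Pi.single_apply]
  have h4 : ∑ k, P (Pi.single i 1) k * x k = ∑ k, x k * P (Pi.single i 1) k :=
    Finset.sum_congr rfl fun k _ => mul_comm _ _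
  have h5 : ∑ k, P (Pi.single i 1) k * P x k = ∑ k, P x k * P (Pi.single i 1) k :=
    Finset.sum_congr rfl fun k _ => mul_comm _ _
  linarith

lemma sqrt_sum_sq_le_OmegaF {n : ℕ} (hn : n ≠ 0) (P : (Fin n → ℝ) →ₗ[ℝ] (Fin n → ℝ))
    (i : Fin n) : √(∑ k, P (Pi.single i 1) k ^ 2) ≤ OmegaF n P := by
  have h := le_ciSup (f := fun i : Fin n =>
    norm2 n (P (Pi.single i 1)) / norm2 n (Pi.single i 1)) (Set.finite_range _).bddAbove i
  refine le_trans (le_of_eq ?_) h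
  have hn' : (0 : ℝ) < n := by exact_mod_cast Nat.pos_of_ne_zero hn
  have h1 : ∑ k, (Pi.single i 1 : Fin n → ℝ) k ^ 2 = 1 := by
    simp [Pi.single_apply]
  simp only [norm2, h1]
  rw [← Real.sqrt_div' _ (by positivity)]
  congr 1
  field_simp

/-- The residual sum of squares is the sum of squared coordinates along an orthonormal basis of
the orthogonal complement. -/
lemma IsOrthProjOn.exists_orthonormal_sum_sq {n d : ℕ} (hn : n ≠ 0)
    {F : Submodule ℝ (Fin n → ℝ)} (hd : Module.finrank ℝ F = d)
    {P : (Fin n → ℝ) →ₗ[ℝ] (Fin n → ℝ)} (hP : IsOrthProjOn n F P) :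
    ∃ b : Fin (n - d) → EuclideanSpace ℝ (Fin n), Orthonormal ℝ b ∧
      ∀ y : Fin n → ℝ, ∑ i, (y i - P y i) ^ 2 = ∑ l, (∑ i, b l i * y i) ^ 2 := by
  set e : (Fin n → ℝ) ≃ₗ[ℝ] EuclideanSpace ℝ (Fin n) := (WithLp.linearEquiv 2 ℝ (Fin n → ℝ)).symm
  set V : Submodule ℝ (EuclideanSpace ℝ (Fin n)) := F.map e.toLinearMap
  have hV : Module.finrank ℝ V = d := by
    rw [← hd]
    exact LinearEquiv.finrank_map_eq e F
  have hVo : Module.finrank ℝ Vᗮ = n - d := by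
    have := V.finrank_add_finrank_orthogonal
    rw [finrank_euclideanSpace_fin, hV] at this
    omega
  let b := (stdOrthonormalBasis ℝ Vᗮ).reindex (finCongr hVo)
  have hinner (u w : Fin n → ℝ) : inner ℝ (e u) (e w) = ∑ i, w i * u i := by
    simp [e, PiLp.inner_apply]
  refine ⟨fun l => (b l : EuclideanSpace ℝ (Fin n)), ?_, fun y => ?_⟩
  · exact b.orthonormal.comp_linearIsometry Vᗮ.subtypeₗᵢ
  have hres : e (y - P y) ∈ Vᗮ := by
    rw [Submodule.mem_orthogonal]
    rintro _ ⟨g, hg, rfl⟩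
    exact (hinner g (y - P y)).trans (sum_mul_eq_zero_of_isOrthProjOn hn hP y hg)
  have hPy : e (P y) ∈ V := ⟨P y, hP.1 y, rfl⟩
  have hsum := b.sum_sq_inner_right ⟨e (y - P y), hres⟩
  have hnorm : ‖(⟨e (y - P y), hres⟩ : Vᗮ)‖ ^ 2 = ∑ i, (y i - P y i) ^ 2 := by
    rw [Submodule.coe_norm, EuclideanSpace.real_norm_sq_eq]
    rfl
  rw [← hnorm, ← hsum]
  refine Finset.sum_congr rfl fun l _ => ?_
  congr 1
  have h0 : inner ℝ (b l : EuclideanSpace ℝ (Fin n)) (e (P y)) = 0 :=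
    (Submodule.mem_orthogonal' V _).1 (b l).2 _ hPy
  have h1 : inner ℝ (b l : EuclideanSpace ℝ (Fin n)) (e (y - P y)) =
      inner ℝ (b l : EuclideanSpace ℝ (Fin n)) (e y) := by
    rw [map_sub, inner_sub_right, h0, sub_zero]
  refine h1.trans ?_
  exact (hinner (b l : EuclideanSpace ℝ (Fin n)).ofLp y).trans
    (Finset.sum_congr rfl fun i _ => mul_comm _ _)

/-- Law of the residual sum of squares under the Gaussian model. -/
lemma gaussP_residual_le {n k : ℕ} {P : (Fin n → ℝ) →ₗ[ℝ] (Fin n → ℝ)}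
    {b : Fin k → EuclideanSpace ℝ (Fin n)} (hb : Orthonormal ℝ b)
    (hP : ∀ y : Fin n → ℝ, ∑ i, (y i - P y i) ^ 2 = ∑ l, (∑ i, b l i * y i) ^ 2)
    (f : Fin n → ℝ) (q : ℝ) :
    gaussP n f 1 {y | ∑ i, (y i - P y i) ^ 2 ≤ q} =
      stdPi k {z | ∑ l, (z l + ∑ i, b l i * f i) ^ 2 ≤ q} := by
  simp only [hP]
  rw [gaussP_one_apply f (measurableSet_le (by fun_prop) (by fun_prop)),
    ← map_orthonormal_stdPi hb,
    Measure.map_apply (by fun_prop) (measurableSet_le (by fun_prop) (by fun_prop))]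
  congr 1
  ext x
  simp [mul_add, Finset.sum_add_distrib]

lemma ofReal_le_stdPi_chiSqQuantile {k : ℕ} {p : ℝ} (h1 : p < 1) :
    ENNReal.ofReal p ≤ stdPi k {z | ∑ l, z l ^ 2 ≤ chiSqQuantile k p} := by
  set ν : Measure ℝ := (stdPi k).map fun z => ∑ l, z l ^ 2
  have : IsProbabilityMeasure ν := Measure.isProbabilityMeasure_map (Measurable.aemeasurable (by fun_prop))
  have hν (t : ℝ) : stdPi k {z | ∑ l, z l ^ 2 ≤ t} = ENNReal.ofReal (cdf ν t) := by
    rw [ofReal_cdf, Measure.map_apply (by fun_prop) measurableSet_Iic]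
    rfl
  rw [chiSqQuantile]
  simp only [hν]
  have hp (t : ℝ) : ENNReal.ofReal p ≤ ENNReal.ofReal (cdf ν t) ↔ p ≤ cdf ν t :=
    ENNReal.ofReal_le_ofReal_iff (cdf_nonneg _ _)
  simp only [hp]
  set S := {t : ℝ | p ≤ cdf ν t}
  have hne : S.Nonempty := ((tendsto_cdf_atTop ν).eventually_const_le h1).exists
  have hright : ContinuousWithinAt (cdf ν) (Set.Ioi (sInf S)) (sInf S) :=
    ((cdf ν).right_continuous _).mono Set.Ioi_subset_Ici_self
  refine ge_of_tendsto hright ?_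
  filter_upwards [self_mem_nhdsWithin] with t ht
  obtain ⟨s, hs, hst⟩ := exists_lt_of_csInf_lt hne ht
  exact le_trans hs (monotone_cdf ν hst.le)

/-- Simultaneous two-sided bound for `n` linear functionals of the noise. -/
lemma gaussP_exists_lt_abs_le {n : ℕ} (hn : n ≠ 0) (f : Fin n → ℝ) {a : ℝ} (ha0 : 0 < a)
    (ha1 : a < 1) (v : Fin n → Fin n → ℝ) {Ω : ℝ} (hv : ∀ i, √(∑ k, v i k ^ 2) ≤ Ω) :
    gaussP n f 1 {y | ∃ i, Ω * PhiInv (1 - a / (2 * n)) < |∑ k, v i k * (y k - f k)|} ≤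
      ENNReal.ofReal a := by
  have hn1 : (1 : ℝ) ≤ n := by exact_mod_cast Nat.one_le_iff_ne_zero.2 hn
  have hpos : 0 < a / (2 * n) := by positivity
  have hlt : a / (2 * n) < 1 / 2 := by
    rw [div_lt_div_iff₀ (by positivity) two_pos]
    linarith
  have hcdf := stdCDF_PhiInv (p := 1 - a / (2 * n)) (by linarith) (by linarith)
  have hz : 0 ≤ PhiInv (1 - a / (2 * n)) := nonneg_of_half_lt_stdCDF (by linarith)
  set z := PhiInv (1 - a / (2 * n))
  have hset (i : Fin n) : MeasurableSet {y : Fin n → ℝ | Ω * z < |∑ k, v i k * (y k - f k)|} :=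
    measurableSet_lt (by fun_prop) (by fun_prop)
  have hone (i : Fin n) : gaussP n f 1 {y | Ω * z < |∑ k, v i k * (y k - f k)|} ≤
      ENNReal.ofReal (a / n) := by
    rw [gaussP_one_apply f (hset i)]
    refine le_trans (le_of_eq ?_) ((stdPi_lt_abs_sum_le (v i) hz (hv i)).trans (le_of_eq ?_))
    · congr 1
      ext x
      simp
    · rw [hcdf]
      congr 1
      field_simp
      ring
  have hunion : {y | ∃ i, Ω * z < |∑ k, v i k * (y k - f k)|} =
      ⋃ i, {y : Fin n → ℝ | Ω * z < |∑ k, v i k * (y k - f k)|} := by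
    ext y
    simp
  rw [hunion]
  calc gaussP n f 1 (⋃ i, {y : Fin n → ℝ | Ω * z < |∑ k, v i k * (y k - f k)|})
      ≤ ∑ i, gaussP n f 1 {y | Ω * z < |∑ k, v i k * (y k - f k)|} := measure_iUnion_fintype_le _ _
    _ ≤ ∑ _i : Fin n, ENNReal.ofReal (a / n) := Finset.sum_le_sum fun i _ => hone i
    _ = ENNReal.ofReal a := by
        rw [Finset.sum_const, Finset.card_univ, Fintype.card_fin, ← ENNReal.ofReal_nsmul,
          nsmul_eq_mul]
        congr 1
        field_simp

instance isProbabilityMeasure_gaussP (n : ℕ) (f : Fin n → ℝ) (σ : ℝ) :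
    IsProbabilityMeasure (gaussP n f σ) := by
  unfold gaussP
  infer_instance

lemma ofReal_one_sub_le_measure_of_univ_subset {X ι : Type*} [MeasurableSpace X] [Fintype ι]
    {μ : Measure X} [IsProbabilityMeasure μ] {S : Set X} {B : ι → Set X} {a : ι → ℝ} {α : ℝ}
    (ha : ∀ j, 0 ≤ a j) (hB : ∀ j, μ (B j) ≤ ENNReal.ofReal (a j)) (hsum : ∑ j, a j ≤ α)
    (hcov : ∀ x, x ∈ S ∨ ∃ j, x ∈ B j) : ENNReal.ofReal (1 - α) ≤ μ S := by
  have h1 : (1 : ENNReal) ≤ μ S + ENNReal.ofReal α := by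
    calc (1 : ENNReal) = μ Set.univ := measure_univ.symm
      _ ≤ μ (S ∪ ⋃ j, B j) := measure_mono fun x _ => by
          simpa using hcov x
      _ ≤ μ S + ∑ j, μ (B j) :=
          (measure_union_le _ _).trans (add_le_add_right (measure_iUnion_fintype_le _ _) _)
      _ ≤ μ S + ∑ j, ENNReal.ofReal (a j) :=
          add_le_add_right (Finset.sum_le_sum fun j _ => hB j) _
      _ ≤ μ S + ENNReal.ofReal α := by
          rw [← ENNReal.ofReal_sum_of_nonneg fun j _ => ha j]
          exact add_le_add_right (ENNReal.ofReal_le_ofReal hsum) _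
  have hα : 0 ≤ α := (Finset.sum_nonneg fun j _ => ha j).trans hsum
  rw [ENNReal.ofReal_sub _ hα, ENNReal.ofReal_one]
  exact tsub_le_iff_right.2 h1

lemma Jhat_le (n m : ℕ) (Pj : Fin m → ((Fin n → ℝ) →ₗ[ℝ] (Fin n → ℝ)))
    (dd : Fin m → ℕ) (γ : ℝ) (y : Fin n → ℝ) : Jhat n m Pj dd γ y ≤ m :=
  Nat.sInf_le (Or.inr rfl)

lemma Jhat_le_of_Tj_le {n m : ℕ} {Pj : Fin m → ((Fin n → ℝ) →ₗ[ℝ] (Fin n → ℝ))}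
    {dd : Fin m → ℕ} {γ : ℝ} {y : Fin n → ℝ} {j : Fin m}
    (h : Tj n m Pj j y ≤ qj n m dd γ j) : Jhat n m Pj dd γ y ≤ j :=
  Nat.sInf_le (Or.inl ⟨j.2, h⟩)

lemma Tj_le_of_Jhat_eq {n m : ℕ} {Pj : Fin m → ((Fin n → ℝ) →ₗ[ℝ] (Fin n → ℝ))}
    {dd : Fin m → ℕ} {γ : ℝ} {y : Fin n → ℝ} {j : Fin m}
    (h : Jhat n m Pj dd γ y = j) : Tj n m Pj j y ≤ qj n m dd γ j := by
  have hmem := Nat.sInf_mem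
    (s := {j : ℕ | ∃ h : j < m, Tj n m Pj ⟨j, h⟩ y ≤ qj n m dd γ ⟨j, h⟩} ∪ {m})
    ⟨m, Or.inr rfl⟩
  change Jhat n m Pj dd γ y ∈ _ at hmem
  rw [h] at hmem
  rcases hmem with ⟨_, hT⟩ | hm
  · exact hT
  · exact absurd hm j.2.ne

lemma covers_iff_abs_sub_le {n m : ℕ} {Pj : Fin m → ((Fin n → ℝ) →ₗ[ℝ] (Fin n → ℝ))}
    {dd : Fin m → ℕ} {γ : ℝ} {εinf : Fin m → ℝ} {αv : Fin (m + 1) → ℝ} {g y : Fin n → ℝ} :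
    covers n (nbandL n m Pj dd γ εinf αv) (nbandU n m Pj dd γ εinf αv) g y ↔
      ∀ i, |centerHat n m Pj dd γ y i - g i| ≤ cj n m Pj εinf αv (Jhat n m Pj dd γ y) := by
  refine forall_congr' fun i => ?_
  simp only [nbandL, nbandU, abs_le]
  constructor <;> rintro ⟨h1, h2⟩ <;> constructor <;> linarith

lemma width_nband {n m : ℕ} (hn : n ≠ 0) (Pj : Fin m → ((Fin n → ℝ) →ₗ[ℝ] (Fin n → ℝ)))
    (dd : Fin m → ℕ) (γ : ℝ) (εinf : Fin m → ℝ) (αv : Fin (m + 1) → ℝ) (y : Fin n → ℝ) :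
    width n (nbandL n m Pj dd γ εinf αv) (nbandU n m Pj dd γ εinf αv) y =
      2 * cj n m Pj εinf αv (Jhat n m Pj dd γ y) := by
  have : NeZero n := ⟨hn⟩
  have h (i : Fin n) : nbandU n m Pj dd γ εinf αv y i - nbandL n m Pj dd γ εinf αv y i =
      2 * cj n m Pj εinf αv (Jhat n m Pj dd γ y) := by
    simp only [nbandL, nbandU]
    ring
  simp only [width, h]
  exact ciSup_const

lemma abs_le_normInf {n : ℕ} (v : Fin n → ℝ) (i : Fin n) : |v i| ≤ normInf n v :=
  le_ciSup (f := fun i => |v i|) (Set.finite_range _).bddAbove i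

lemma mul_sq_le_of_lt_norm2 {n : ℕ} (hn : n ≠ 0) {v : Fin n → ℝ} {ε : ℝ} (hε : 0 < ε)
    (h : ε < norm2 n v) : n * ε ^ 2 ≤ ∑ i, v i ^ 2 := by
  have hn' : (0 : ℝ) < n := by exact_mod_cast Nat.pos_of_ne_zero hn
  have h1 := (Real.lt_sqrt hε.le).1 h
  rw [lt_div_iff₀ hn'] at h1
  linarith

/-- the nested pretesting band has valid nested surrogate coverage,
and (when the half-widths are increasing) attains width `2c_j` with probability
at least `1−γ` uniformly over each `F_j` (σ = 1). -/
theorem nested_surrogate_band_achievability (n m : ℕ)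
    (F : Fin m → Submodule ℝ (Fin n → ℝ))
    (dd : Fin m → ℕ)
    (hnest : ∀ j k : Fin m, j < k → F j < F k)
    (hdim : ∀ j, Module.finrank ℝ (F j) = dd j)
    (hdmono : ∀ j k : Fin m, j < k → dd j < dd k)
    (hdn : ∀ j, dd j < n)
    (Pj : Fin m → ((Fin n → ℝ) →ₗ[ℝ] (Fin n → ℝ)))
    (hPj : ∀ j, IsOrthProjOn n (F j) (Pj j))
    (ε2 εinf : Fin m → ℝ) (hε2 : ∀ j, 0 < ε2 j) (hεinf : ∀ j, 0 < εinf j)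
    (γ : ℝ) (hγ : 0 < γ) (hγ1 : γ < 1)
    (αv : Fin (m + 1) → ℝ) (hαv : ∀ j, 0 < αv j ∧ αv j < 1)
    (α : ℝ) (hsum : ∑ j, αv j ≤ α)
    (hnc : ∀ j : Fin m, ∀ a : Fin (n - dd j) → ℝ,
      (n : ℝ) * (ε2 j) ^ 2 ≤ ∑ k, (a k) ^ 2 →
      ((Measure.pi fun _ : Fin (n - dd j) => gaussianReal 0 1)
        {z | ∑ k, (z k + a k) ^ 2 ≤ qj n m dd γ j}).toReal ≤ αv ⟨j, by omega⟩) :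
    (∀ f : Fin n → ℝ,
      ENNReal.ofReal (1 - α) ≤ gaussP n f 1
        {y | ∃ g ∈ surrogateSet n m Pj ε2 εinf f,
          covers n (nbandL n m Pj dd γ εinf αv) (nbandU n m Pj dd γ εinf αv) g y}) ∧
    ((∀ j k : ℕ, j ≤ k → k ≤ m → cj n m Pj εinf αv j ≤ cj n m Pj εinf αv k) →
      ∀ j : Fin m, ∀ f ∈ F j,
        ENNReal.ofReal (1 - γ) ≤ gaussP n f 1
          {y | width n (nbandL n m Pj dd γ εinf αv) (nbandU n m Pj dd γ εinf αv) y ≤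
                2 * cj n m Pj εinf αv j}) := by
  refine ⟨fun f => ?_, fun hc j f hf => ?_⟩
  · rcases eq_or_ne n 0 with rfl | hn
    · refine ofReal_one_sub_le_measure_of_univ_subset (B := fun _ => ∅)
        (fun j => (hαv j).1.le) (fun j => by simp) hsum fun y => Or.inl ?_
      exact ⟨f, Or.inl rfl, fun i => i.elim0⟩
    suffices hbad : ∀ j : Fin (m + 1), ∃ B : Set (Fin n → ℝ),
        gaussP n f 1 B ≤ ENNReal.ofReal (αv j) ∧ ∀ y ∉ B, Jhat n m Pj dd γ y = j →
          ∃ g ∈ surrogateSet n m Pj ε2 εinf f,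
            covers n (nbandL n m Pj dd γ εinf αv) (nbandU n m Pj dd γ εinf αv) g y by
      choose B hB hcov using hbad
      refine ofReal_one_sub_le_measure_of_univ_subset (fun j => (hαv j).1.le) hB hsum fun y => ?_
      by_cases hy : y ∈ B ⟨Jhat n m Pj dd γ y, Nat.lt_succ_of_le (Jhat_le n m Pj dd γ y)⟩
      · exact Or.inr ⟨_, hy⟩
      · exact Or.inl (hcov _ y hy rfl)
    rintro ⟨j, hj⟩
    rcases (Nat.lt_succ_iff.1 hj).lt_or_eq with hjm | rfl
    · by_cases hA : ε2 ⟨j, hjm⟩ < norm2 n (f - Pj ⟨j, hjm⟩ f)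
      · refine ⟨{y | Tj n m Pj ⟨j, hjm⟩ y ≤ qj n m dd γ ⟨j, hjm⟩}, ?_, fun y hy hJ =>
          absurd (Tj_le_of_Jhat_eq (j := ⟨j, hjm⟩) hJ) hy⟩
        obtain ⟨b, hb, hsq⟩ := (hPj ⟨j, hjm⟩).exists_orthonormal_sum_sq hn (hdim ⟨j, hjm⟩)
        refine (gaussP_residual_le hb hsq f _).trans_le ?_
        rw [← ENNReal.ofReal_toReal (measure_ne_top (stdPi (n - dd ⟨j, hjm⟩)) _)]
        refine ENNReal.ofReal_le_ofReal (hnc ⟨j, hjm⟩ (fun l => ∑ i, b l i * f i) ?_)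
        rw [← hsq f]
        exact mul_sq_le_of_lt_norm2 hn (hε2 _) hA
      · have hbound := gaussP_exists_lt_abs_le hn f (hαv ⟨j, hj⟩).1 (hαv ⟨j, hj⟩).2
          (fun i => Pj ⟨j, hjm⟩ (Pi.single i 1)) (sqrt_sum_sq_le_OmegaF hn (Pj ⟨j, hjm⟩))
        refine ⟨_, hbound, fun y hy hJ => ?_⟩
        simp only [Set.mem_ofPred_eq, not_exists, not_lt] at hy
        replace hJ : Jhat n m Pj dd γ y = j := hJ
        have hcenter : centerHat n m Pj dd γ y = Pj ⟨j, hjm⟩ y := by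
          simp only [centerHat, hJ, hjm, dif_pos]
        have hcj : cj n m Pj εinf αv j = OmegaF n (Pj ⟨j, hjm⟩) *
            PhiInv (1 - αv ⟨j, hj⟩ / (2 * n)) + εinf ⟨j, hjm⟩ := by
          simp only [cj, hjm, dif_pos]
        have hnoise (i : Fin n) : |Pj ⟨j, hjm⟩ y i - Pj ⟨j, hjm⟩ f i| ≤
            OmegaF n (Pj ⟨j, hjm⟩) * PhiInv (1 - αv ⟨j, hj⟩ / (2 * n)) := by
          have h := (hPj ⟨j, hjm⟩).apply_eq_sum hn (y - f) i
          rw [map_sub, Pi.sub_apply] at h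
          rw [h]
          exact hy i
        by_cases hC : εinf ⟨j, hjm⟩ < normInf n (f - Pj ⟨j, hjm⟩ f)
        · refine ⟨Pj ⟨j, hjm⟩ f, Or.inr ⟨⟨j, hjm⟩, not_lt.1 hA, hC, rfl⟩, ?_⟩
          rw [covers_iff_abs_sub_le, hcenter, hJ, hcj]
          intro i
          linarith [hnoise i, hεinf ⟨j, hjm⟩]
        · refine ⟨f, Or.inl rfl, ?_⟩
          rw [covers_iff_abs_sub_le, hcenter, hJ, hcj]
          intro i
          have hbias := (abs_le_normInf (f - Pj ⟨j, hjm⟩ f) i).trans (not_lt.1 hC)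
          rw [Pi.sub_apply, abs_sub_comm] at hbias
          exact (abs_sub_le _ (Pj ⟨j, hjm⟩ f i) _).trans (add_le_add (hnoise i) hbias)
    · have hbound := gaussP_exists_lt_abs_le hn f (hαv ⟨j, hj⟩).1 (hαv ⟨j, hj⟩).2
        (fun i => Pi.single i 1) (Ω := 1) (fun i => by simp [Pi.single_apply])
      refine ⟨_, hbound, fun y hy hJ => ⟨f, Or.inl rfl, ?_⟩⟩
      simp only [Set.mem_ofPred_eq, not_exists, not_lt] at hy
      replace hJ : Jhat n j Pj dd γ y = j := hJ
      have hcenter : centerHat n j Pj dd γ y = y := by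
        simp [centerHat, hJ]
      have hcj : cj n j Pj εinf αv j = PhiInv (1 - αv ⟨j, hj⟩ / (2 * n)) := by
        simp [cj]
      rw [covers_iff_abs_sub_le, hcenter, hJ, hcj]
      intro i
      simpa [Pi.single_apply] using hy i
  · have hn : n ≠ 0 := (Nat.zero_le _).trans_lt (hdn j) |>.ne'
    obtain ⟨b, hb, hsq⟩ := (hPj j).exists_orthonormal_sum_sq hn (hdim j)
    have hzero : ∀ l, ∑ i, b l i * f i = 0 := by
      have h := hsq f
      simp only [(hPj j).apply_eq_self hn hf, sub_self, ne_eq, OfNat.ofNat_ne_zero,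
        not_false_eq_true, zero_pow, Finset.sum_const_zero] at h
      intro l
      exact pow_eq_zero_iff two_ne_zero |>.1 <|
        (Finset.sum_eq_zero_iff_of_nonneg fun l _ => sq_nonneg _).1 h.symm l (Finset.mem_univ l)
    have hlaw := gaussP_residual_le hb hsq f (qj n m dd γ j)
    simp only [hzero, add_zero] at hlaw
    calc ENNReal.ofReal (1 - γ)
        ≤ stdPi (n - dd j) {z | ∑ l, z l ^ 2 ≤ qj n m dd γ j} :=
          ofReal_le_stdPi_chiSqQuantile (by linarith)
      _ = gaussP n f 1 {y | ∑ i, (y i - Pj j y i) ^ 2 ≤ qj n m dd γ j} := hlaw.symm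
      _ ≤ _ := measure_mono fun y hy => by
          rw [Set.mem_ofPred_eq, width_nband hn]
          have := hc _ j (Jhat_le_of_Tj_le hy) j.2.le
          linarith

end
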